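/- arXiv:2509.20056 — 4 statements merged into one kernel-verified Lean document; each statement's English description precedes it below -/
import Mathlib

section
/- Let W₁,…,W_N ∈ ℝᵖ be arbitrary anisotropic basis vectors and suppose the moment matrix M = Σ_{j=1}^N X_j W_jᵀ ∈ ℝ^{p×p} is invertible. Fix a multi-index α with |α| ≤ m and define weights w_j = W_j · (M⁻¹ C^α). Then these weights satisfy the discrete moment conditions Σ_j X_j w_j = C^α, and consequently the discrete operator is exact on polynomials: Σ_j u*(x_j) w_j = (∂^α u*)(xᵢ) for every polynomial u* in n variables of total degree at most m. -/
open scoped BigOperators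
open Matrix

/-- The iterated partial derivative `∂^α` of a multivariate polynomial, where `α` is a
multi-index. -/
noncomputable def pderivIter {n : ℕ} (α : Fin n → ℕ) (p : MvPolynomial (Fin n) ℝ) :
    MvPolynomial (Fin n) ℝ :=
  (List.finRange n).foldr (fun i q => (fun r => MvPolynomial.pderiv i r)^[α i] q) p

/-- The (finite) set of multi-indices `α ∈ ℕⁿ` with `|α| = Σ αᵢ ≤ m`. -/
def multiIndices (n m : ℕ) : Finset (Fin n → ℕ) :=
  (Fintype.piFinset fun _ : Fin n => Finset.range (m + 1)).filter fun α => ∑ i, α i ≤ m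

namespace MvPolynomial

theorem coeff_iterate_pderiv {σ R : Type*} [CommSemiring R] (i : σ) (k : ℕ)
    (q : MvPolynomial σ R) (β : σ →₀ ℕ) :
    coeff β ((fun r => pderiv i r)^[k] q) =
      coeff (β + Finsupp.single i k) q * ((β i + 1).ascFactorial k : R) := by
  induction k generalizing q with
  | zero => simp
  | succ k ih =>
    rw [Function.iterate_succ_apply, ih, coeff_pderiv, Nat.ascFactorial_succ, add_assoc,
      ← Finsupp.single_add]
    simp only [Finsupp.add_apply, Finsupp.single_eq_same]
    push_cast
    ring

theorem coeff_foldr_iterate_pderiv {σ R : Type*} [CommSemiring R] (α : σ → ℕ)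
    (q : MvPolynomial σ R) (l : List σ) (hl : l.Nodup) (β : σ →₀ ℕ) (hβ : ∀ i ∈ l, β i = 0) :
    coeff β (l.foldr (fun i q => (fun r => pderiv i r)^[α i] q) q) =
      coeff (β + (l.map fun i => Finsupp.single i (α i)).sum) q *
        (l.map fun i => ((α i).factorial : R)).prod := by
  induction l generalizing β with
  | nil => simp
  | cons i l ih =>
    obtain ⟨hi, hl⟩ := List.nodup_cons.mp hl
    have hβ' : ∀ j ∈ l, (β + Finsupp.single i (α i)) j = 0 := fun j hj => by
      have hne : j ≠ i := fun h => hi (h ▸ hj)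
      simp [hβ j (List.mem_cons_of_mem i hj), hne]
    rw [List.foldr_cons, coeff_iterate_pderiv, ih hl _ hβ', hβ i List.mem_cons_self, zero_add,
      Nat.one_ascFactorial, List.map_cons, List.map_cons, List.sum_cons, List.prod_cons,
      add_assoc, mul_assoc, mul_comm (List.prod _)]

/-- The polynomial `u(X + a)`. -/
noncomputable def translate {σ R : Type*} [CommSemiring R] (a : σ → R) :
    MvPolynomial σ R →ₐ[R] MvPolynomial σ R :=
  aeval fun i => X i + C (a i)

theorem eval_translate {σ R : Type*} [CommSemiring R] (a y : σ → R) (u : MvPolynomial σ R) :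
    eval y (translate a u) = eval (y + a) u := by
  induction u using MvPolynomial.induction_on with
  | C r => simp [translate]
  | add p q hp hq => simp [hp, hq]
  | mul_X p i hp => rw [map_mul, map_mul, hp]; simp [translate]

theorem pderiv_translate {σ R : Type*} [CommSemiring R] (a : σ → R) (i : σ)
    (u : MvPolynomial σ R) : pderiv i (translate a u) = translate a (pderiv i u) := by
  classical
  induction u using MvPolynomial.induction_on with
  | C r => simp [translate]
  | add p q hp hq => simp [hp, hq]
  | mul_X p j hp =>
    rw [map_mul, pderiv_mul, pderiv_mul, hp, map_add, map_mul, map_mul]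
    congr 2
    by_cases h : i = j
    · subst h; simp [translate]
    · simp [translate, Ne.symm h]

theorem totalDegree_translate_le {σ R : Type*} [CommSemiring R] (a : σ → R)
    (u : MvPolynomial σ R) : (translate a u).totalDegree ≤ u.totalDegree := by
  rw [translate, aeval_def, eval₂_eq]
  refine totalDegree_finsetSum_le fun d hd => (totalDegree_mul _ _).trans ?_
  rw [algebraMap_eq, totalDegree_C, zero_add]
  refine (totalDegree_finsetProd _ _).trans (le_trans (Finset.sum_le_sum fun i _ => ?_)
    (le_totalDegree hd))
  have h : (X i + C (a i) : MvPolynomial σ R).totalDegree ≤ 1 := by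
    refine (totalDegree_add _ _).trans (max_le ?_ (by simp))
    exact (totalDegree_monomial_le _ _).trans (by simp)
  exact (totalDegree_pow _ _).trans (by simpa using Nat.mul_le_mul_left (d i) h)

end MvPolynomial

open MvPolynomial in
theorem pderivIter_translate {n : ℕ} (a : Fin n → ℝ) (α : Fin n → ℕ)
    (u : MvPolynomial (Fin n) ℝ) :
    pderivIter α (translate a u) = translate a (pderivIter α u) := by
  unfold pderivIter
  induction List.finRange n with
  | nil => rfl
  | cons i l ih =>
    rw [List.foldr_cons, List.foldr_cons, ih]
    exact ((Function.Semiconj.iterate_right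
      (fun v => (pderiv_translate a i v).symm) (α i)) _).symm

open MvPolynomial in
theorem eval_zero_pderivIter {n : ℕ} (α : Fin n → ℕ) (u : MvPolynomial (Fin n) ℝ) :
    eval 0 (pderivIter α u) =
      coeff (Finsupp.equivFunOnFinite.symm α) u * ∏ i, ((α i).factorial : ℝ) := by
  rw [eval_zero, constantCoeff_eq, pderivIter,
    coeff_foldr_iterate_pderiv α u _ (List.nodup_finRange n) 0 (fun _ _ => rfl), zero_add,
    ← List.ofFn_eq_map, ← List.ofFn_eq_map, List.sum_ofFn, List.prod_ofFn]
  congr 2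
  ext i
  simp [Finsupp.finsetSum_apply, Finsupp.single_apply]

theorem mem_multiIndices {n m : ℕ} {β : Fin n → ℕ} :
    β ∈ multiIndices n m ↔ ∑ i, β i ≤ m := by
  simp only [multiIndices, Finset.mem_filter, Fintype.mem_piFinset, Finset.mem_range,
    and_iff_right_iff_imp]
  exact fun h i => Nat.lt_succ_of_le
    ((Finset.single_le_sum (fun _ _ => Nat.zero_le _) (Finset.mem_univ i)).trans h)

open MvPolynomial in
theorem eval_eq_sum_multiIndices {n m : ℕ} {v : MvPolynomial (Fin n) ℝ}
    (hv : v.totalDegree ≤ m) (y : Fin n → ℝ) :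
    eval y v = ∑ β : ↥(multiIndices n m),
      coeff (Finsupp.equivFunOnFinite.symm (β : Fin n → ℕ)) v * ∏ i, y i ^ (β : Fin n → ℕ) i := by
  rw [Finset.sum_coe_sort (multiIndices n m) fun β : Fin n → ℕ =>
    coeff (Finsupp.equivFunOnFinite.symm β) v * ∏ i, y i ^ β i, eval_eq']
  have hinj : Set.InjOn (fun d : Fin n →₀ ℕ => (d : Fin n → ℕ)) v.support :=
    DFunLike.coe_injective.injOn
  have himage : v.support.image (fun d : Fin n →₀ ℕ => (d : Fin n → ℕ)) ⊆ multiIndices n m := by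
    intro β hβ
    obtain ⟨d, hd, rfl⟩ := Finset.mem_image.mp hβ
    refine mem_multiIndices.mpr (le_trans ?_ ((le_totalDegree hd).trans hv))
    rw [Finsupp.sum_fintype _ _ fun _ => rfl]
  rw [← Finset.sum_subset himage, Finset.sum_image hinj]
  · simp
  · intro β _ hβ
    have : coeff (Finsupp.equivFunOnFinite.symm β) v = 0 := by
      by_contra h
      exact hβ (Finset.mem_image.mpr ⟨_, mem_support_iff.mpr h, by simp⟩)
    rw [this, zero_mul]

/-- Approximation-of-moments weights `wⱼ = Wⱼ · (M⁻¹ C^α)`, with arbitrary anisotropic basis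
vectors `Wⱼ` and invertible moment matrix `M = Σⱼ Xⱼ Wⱼᵀ`, satisfy the discrete moment
conditions `Σⱼ Xⱼ wⱼ = C^α`, and consequently the discrete operator is exact on polynomials of
total degree at most `m`. -/
theorem aom_weights_moment_conditions_and_exactness
    (n m N : ℕ) (hn : 1 ≤ n)
    (xi : Fin n → ℝ) (x : Fin N → Fin n → ℝ)
    (α : Fin n → ℕ) (hα : ∑ i, α i ≤ m)
    (X : Fin N → ↥(multiIndices n m) → ℝ)
    (hX : ∀ j β, X j β =
      (∏ i, (x j i - xi i) ^ (β : Fin n → ℕ) i) / ∏ i, (((β : Fin n → ℕ) i).factorial : ℝ))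
    (W : Fin N → ↥(multiIndices n m) → ℝ)
    (M : Matrix ↥(multiIndices n m) ↥(multiIndices n m) ℝ)
    (hM : M = Matrix.of fun β γ => ∑ j, X j β * W j γ)
    (hMinv : IsUnit M.det)
    (Cα : ↥(multiIndices n m) → ℝ)
    (hC : ∀ β, Cα β = if (β : Fin n → ℕ) = α then 1 else 0)
    (w : Fin N → ℝ)
    (hw : ∀ j, w j = W j ⬝ᵥ (M⁻¹ *ᵥ Cα)) :
    (∀ β, ∑ j, X j β * w j = Cα β) ∧
    (∀ u : MvPolynomial (Fin n) ℝ, u.totalDegree ≤ m →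
        ∑ j, MvPolynomial.eval (x j) u * w j = MvPolynomial.eval xi (pderivIter α u)) := by
  have hmoment : ∀ β, ∑ j, X j β * w j = Cα β := by
    intro β
    have hMC : M *ᵥ (M⁻¹ *ᵥ Cα) = Cα := by
      rw [Matrix.mulVec_mulVec, Matrix.mul_nonsing_inv _ hMinv, Matrix.one_mulVec]
    rw [← congrFun hMC β]
    generalize M⁻¹ *ᵥ Cα = c at hw
    simp only [hw, hM, Matrix.mulVec, dotProduct, Matrix.of_apply, Finset.mul_sum,
      Finset.sum_mul]
    rw [Finset.sum_comm]
    simp only [mul_assoc]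
  refine ⟨hmoment, fun u hu => ?_⟩
  set v := MvPolynomial.translate xi u with hv
  have hvdeg : v.totalDegree ≤ m := (MvPolynomial.totalDegree_translate_le xi u).trans hu
  have hmonomial : ∀ j (β : ↥(multiIndices n m)), ∏ i, (x j - xi) i ^ (β : Fin n → ℕ) i =
      (∏ i, (((β : Fin n → ℕ) i).factorial : ℝ)) * X j β := by
    intro j β
    rw [hX, mul_div_cancel₀]
    · rfl
    · exact Finset.prod_ne_zero_iff.mpr fun i _ => by positivity
  have heval : ∀ j, MvPolynomial.eval (x j) u = MvPolynomial.eval (x j - xi) v := fun j => by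
    rw [hv, MvPolynomial.eval_translate, sub_add_cancel]
  have hderiv : MvPolynomial.eval xi (pderivIter α u) =
      MvPolynomial.eval 0 (pderivIter α v) := by
    rw [hv, pderivIter_translate, MvPolynomial.eval_translate, zero_add]
  rw [hderiv, eval_zero_pderivIter]
  simp only [heval, eval_eq_sum_multiIndices hvdeg, hmonomial, Finset.sum_mul]
  rw [Finset.sum_comm]
  simp only [mul_assoc, ← Finset.mul_sum, hmoment, hC]
  rw [Finset.sum_eq_single ⟨α, mem_multiIndices.mpr hα⟩]
  · simp
  · intro β _ hβ
    rw [if_neg fun h => hβ (Subtype.ext h), mul_zero, mul_zero]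
  · exact fun h => absurd (Finset.mem_univ _) h
end

section
/- Let X, W ∈ ℝ^{N×p} with M = XᵀW invertible and WᵀW invertible. Consider the Lagrangian of the generalized ℓ₂ minimization problem, ℒ(Ψ, λ) = ½‖WΨ‖² + λ · (MΨ − C) for Ψ, λ ∈ ℝᵖ. Then the pair Ψ* = M⁻¹C, λ* = −M⁻ᵀ (WᵀW) M⁻¹ C is the unique solution of the stationarity system WᵀW Ψ + Mᵀ λ = 0 together with the constraint MΨ = C, and the resulting weights w = WΨ* = W M⁻¹ C satisfy the moment conditions Xᵀw = C; in particular, the discrete operator produced by generalized ℓ₂ minimization is identical to the operator produced by approximation of moments. -/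
open scoped BigOperators
open Matrix

/-- For the generalized ℓ₂ minimization Lagrangian `ℒ(Ψ, λ) = ½‖WΨ‖² + λ·(MΨ − C)` with
`M = XᵀW` and `WᵀW` invertible, the pair `Ψ* = M⁻¹C`, `λ* = −M⁻ᵀ(WᵀW)M⁻¹C` is the unique
solution of the stationarity system `WᵀW Ψ + Mᵀ λ = 0`, `MΨ = C`; the resulting weights
`w = WΨ* = W M⁻¹ C` satisfy the moment conditions `Xᵀw = C`, so the discrete operator of
generalized ℓ₂ minimization is identical to that of approximation of moments. -/
theorem generalized_l2_minimization_eq_aom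
    (N p : ℕ)
    (X W : Matrix (Fin N) (Fin p) ℝ)
    (M : Matrix (Fin p) (Fin p) ℝ) (hM : M = Xᵀ * W)
    (hMinv : IsUnit M.det) (hWW : IsUnit (Wᵀ * W).det)
    (C : Fin p → ℝ)
    (Ψstar lamstar : Fin p → ℝ)
    (hΨ : Ψstar = M⁻¹ *ᵥ C)
    (hlam : lamstar = -((Mᵀ)⁻¹ *ᵥ ((Wᵀ * W) *ᵥ (M⁻¹ *ᵥ C)))) :
    ((Wᵀ * W) *ᵥ Ψstar + Mᵀ *ᵥ lamstar = 0 ∧ M *ᵥ Ψstar = C) ∧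
    (∀ Ψ lam : Fin p → ℝ,
        ((Wᵀ * W) *ᵥ Ψ + Mᵀ *ᵥ lam = 0 ∧ M *ᵥ Ψ = C) → Ψ = Ψstar ∧ lam = lamstar) ∧
    Xᵀ *ᵥ (W *ᵥ Ψstar) = C ∧
    W *ᵥ Ψstar = W *ᵥ (M⁻¹ *ᵥ C) := by
  have hMT : IsUnit Mᵀ.det := by rwa [det_transpose]
  have hsol : M *ᵥ Ψstar = C := by
    rw [hΨ, mulVec_mulVec, mul_nonsing_inv M hMinv, one_mulVec]
  refine ⟨⟨?_, hsol⟩, ?_, ?_, by rw [hΨ]⟩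
  · rw [hlam, hΨ, mulVec_neg, mulVec_mulVec _ Mᵀ, mul_nonsing_inv _ hMT, one_mulVec,
      add_neg_cancel]
  · rintro Ψ lam ⟨hstat, hcon⟩
    have hΨeq : Ψ = M⁻¹ *ᵥ C := by
      rw [← hcon, mulVec_mulVec, nonsing_inv_mul M hMinv, one_mulVec]
    refine ⟨hΨeq.trans hΨ.symm, ?_⟩
    rw [hlam, ← hΨeq, eq_neg_of_add_eq_zero_left hstat, mulVec_neg, neg_neg,
      mulVec_mulVec, nonsing_inv_mul _ hMT, one_mulVec]
  · rw [mulVec_mulVec, ← hM, hsol]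
end

section
/- Let n = 1, m ≥ 1, fix an integer α with 0 ≤ α ≤ m, let all points x₁,…,x_N and the center xᵢ lie in a closed interval [a,b], and let the weights w ∈ ℝᴺ satisfy the moment conditions Σ_{j=1}^N ((x_j − xᵢ)^β/β!) w_j = δ_{αβ} for every integer β with 0 ≤ β ≤ m. If u : ℝ → ℝ is (m+1)-times continuously differentiable on [a,b] with |u^{(m+1)}(t)| ≤ K for all t ∈ [a,b], then the discrete derivative approximation satisfies the consistency error bound |Σ_{j=1}^N u(x_j) w_j − u^{(α)}(xᵢ)| ≤ (K/(m+1)!) Σ_{j=1}^N |w_j| |x_j − xᵢ|^{m+1}. -/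
open scoped BigOperators

/-- Iterated derivatives within a set of unique differentiability agree with those within a
larger such set on which the function is sufficiently smooth. -/
theorem iteratedDerivWithin_subset_of_contDiffOn {f : ℝ → ℝ} {s t : Set ℝ} {n : ℕ} {y : ℝ}
    (hst : s ⊆ t) (hs : UniqueDiffOn ℝ s) (ht : UniqueDiffOn ℝ t) (hf : ContDiffOn ℝ n f t)
    (hy : y ∈ s) : iteratedDerivWithin n f s y = iteratedDerivWithin n f t y := by
  simp only [iteratedDerivWithin, iteratedFDerivWithin_subset hst hs ht hf hy]

/-- Lagrange remainder bound for the Taylor polynomial of `f` at an arbitrary point of `[a,b]`. -/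
theorem abs_sub_taylorWithinEval_Icc_le {f : ℝ → ℝ} {a b c y K : ℝ} {n : ℕ} (hab : a < b)
    (hf : ContDiffOn ℝ (n + 1 : ℕ) f (Set.Icc a b)) (hc : c ∈ Set.Icc a b)
    (hy : y ∈ Set.Icc a b)
    (hK : ∀ t ∈ Set.Icc a b, |iteratedDerivWithin (n + 1) f (Set.Icc a b) t| ≤ K) :
    |f y - taylorWithinEval f n (Set.Icc a b) c y|
      ≤ K / ((n + 1).factorial : ℝ) * |y - c| ^ (n + 1) := by
  rcases eq_or_ne c y with rfl | hcy
  · simp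
  have hsub : Set.uIcc c y ⊆ Set.Icc a b := Set.uIcc_subset_Icc hc hy
  have hs : UniqueDiffOn ℝ (Set.uIcc c y) := uniqueDiffOn_Icc (by simpa using hcy.symm)
  have ht : UniqueDiffOn ℝ (Set.Icc a b) := uniqueDiffOn_Icc hab
  have hf' := hf.mono hsub
  obtain ⟨z, hz, h⟩ := taylor_mean_remainder_lagrange (n := n) hcy
    (hf'.of_le (mod_cast n.le_succ))
    ((hf'.differentiableOn_iteratedDerivWithin (mod_cast n.lt_succ_self) hs).mono
      Set.uIoo_subset_uIcc_self)
  have hz' := Set.uIoo_subset_uIcc_self hz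
  have htaylor : taylorWithinEval f n (Set.uIcc c y) c y
      = taylorWithinEval f n (Set.Icc a b) c y := by
    simp only [taylor_within_apply]
    refine Finset.sum_congr rfl fun k hk => ?_
    rw [iteratedDerivWithin_subset_of_contDiffOn hsub hs ht
      (hf.of_le (mod_cast (Finset.mem_range.mp hk).le)) Set.left_mem_uIcc]
  rw [← htaylor, h, iteratedDerivWithin_subset_of_contDiffOn hsub hs ht hf hz', abs_div, abs_mul,
    abs_pow, Nat.abs_cast, div_mul_eq_mul_div]
  gcongr
  exact hK z (hsub hz')

/-- Weights satisfying the moment conditions of order `α` reproduce the `α`-th derivative from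
the values of a Taylor polynomial. -/
theorem sum_taylorWithinEval_mul_eq {ι : Type*} [Fintype ι] {m α : ℕ} (hα : α ≤ m) {c : ℝ}
    {x w : ι → ℝ}
    (hmom : ∀ β ≤ m, ∑ j, ((x j - c) ^ β / (β.factorial : ℝ)) * w j = if β = α then 1 else 0)
    (f : ℝ → ℝ) (s : Set ℝ) :
    ∑ j, taylorWithinEval f m s c (x j) * w j = iteratedDerivWithin α f s c := by
  calc ∑ j, taylorWithinEval f m s c (x j) * w j
      = ∑ k ∈ Finset.range (m + 1), iteratedDerivWithin k f s c *
          ∑ j, ((x j - c) ^ k / (k.factorial : ℝ)) * w j := by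
        simp only [taylor_within_apply, Finset.sum_mul, Finset.mul_sum]
        rw [Finset.sum_comm]
        refine Finset.sum_congr rfl fun k _ => Finset.sum_congr rfl fun j _ => ?_
        rw [smul_eq_mul]
        ring
    _ = ∑ k ∈ Finset.range (m + 1), iteratedDerivWithin k f s c * if k = α then 1 else 0 :=
        Finset.sum_congr rfl fun k hk => by rw [hmom k (Finset.mem_range_succ_iff.mp hk)]
    _ = iteratedDerivWithin α f s c := by simp [Nat.lt_succ_of_le hα]

/-- One-dimensional consistency error bound: if the weights satisfy the moment conditions
`Σⱼ ((xⱼ − xᵢ)^β / β!) wⱼ = δ_{αβ}` for all `β ≤ m` and `u` is `(m+1)`-times continuously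
differentiable on `[a,b]` with `|u^{(m+1)}| ≤ K` there, then
`|Σⱼ u(xⱼ) wⱼ − u^{(α)}(xᵢ)| ≤ (K/(m+1)!) Σⱼ |wⱼ| |xⱼ − xᵢ|^{m+1}`. -/
theorem one_dim_consistency_error_bound
    (m N : ℕ) (hm : 1 ≤ m) (α : ℕ) (hα : α ≤ m)
    (a b : ℝ) (hab : a < b)
    (xi : ℝ) (hxi : xi ∈ Set.Icc a b)
    (x : Fin N → ℝ) (hx : ∀ j, x j ∈ Set.Icc a b)
    (w : Fin N → ℝ)
    (hmom : ∀ β ≤ m, ∑ j, ((x j - xi) ^ β / (β.factorial : ℝ)) * w j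
      = if β = α then 1 else 0)
    (u : ℝ → ℝ) (hu : ContDiffOn ℝ (m + 1 : ℕ) u (Set.Icc a b))
    (K : ℝ)
    (hK : ∀ t ∈ Set.Icc a b, |iteratedDerivWithin (m + 1) u (Set.Icc a b) t| ≤ K) :
    |∑ j, u (x j) * w j - iteratedDerivWithin α u (Set.Icc a b) xi|
      ≤ (K / ((m + 1).factorial : ℝ)) * ∑ j, |w j| * |x j - xi| ^ (m + 1) := by
  rw [← sum_taylorWithinEval_mul_eq hα hmom u (Set.Icc a b), ← Finset.sum_sub_distrib,
    Finset.mul_sum]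
  refine (Finset.abs_sum_le_sum_abs _ _).trans (Finset.sum_le_sum fun j _ => ?_)
  rw [← sub_mul, abs_mul, mul_comm |w j|, ← mul_assoc]
  gcongr
  exact abs_sub_taylorWithinEval_Icc_le hab hu hxi (hx j) hK
end

section
/- Let X ∈ ℝ^{N×p}, C ∈ ℝᵖ, V ∈ ℝ^{N×N} diagonal with strictly positive entries, fix an index i ∈ {1,…,N} and a real number c, and define the extended monomial vectors X⁺_j = (X_j, δ_{ji}) ∈ ℝ^{p+1} and the extended target C⁺ = (C, c) ∈ ℝ^{p+1}. If the extended moment matrix M⁺ = Σ_{j=1}^N φ_j X⁺_j (X⁺_j)ᵀ ∈ ℝ^{(p+1)×(p+1)} is invertible (where φ_j is the j-th diagonal entry of V), then w*_j = φ_j X⁺_j · ((M⁺)⁻¹ C⁺) is the unique minimizer of J(w) = Σ_j (1/φ_j) w_j² over all w ∈ ℝᴺ satisfying both the moment constraints Σ_j X_j w_j = C and the central-weight constraint w_i = c; in particular w* satisfies both constraints. -/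
open scoped BigOperators
open Matrix

section WeightedLeastNorm

variable {ι κ : Type*} [Fintype ι] [Fintype κ] {Y : ι → κ → ℝ} {φ : ι → ℝ}

/-- The moments of the weights `φⱼ (Yⱼ · a)` are the moment matrix applied to `a`. -/
theorem sum_mul_weighted_dotProduct (Y : ι → κ → ℝ) (φ : ι → ℝ) (a : κ → ℝ) (s : κ) :
    ∑ j, Y j s * (φ j * (Y j ⬝ᵥ a)) =
      ((Matrix.of fun s t => ∑ j, φ j * Y j s * Y j t) *ᵥ a) s := by
  simp only [mulVec, dotProduct, of_apply, Finset.mul_sum, Finset.sum_mul]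
  rw [Finset.sum_comm]
  exact Finset.sum_congr rfl fun t _ => Finset.sum_congr rfl fun j _ => by ring

/-- Pythagorean identity for the weighted energy around weights of the form `φⱼ (Yⱼ · a)`. -/
theorem sum_weighted_sq_eq_add (hφ : ∀ j, 0 < φ j) {a : κ → ℝ} {v w : ι → ℝ}
    (hv : ∀ j, v j = φ j * (Y j ⬝ᵥ a))
    (h : ∀ s, ∑ j, Y j s * w j = ∑ j, Y j s * v j) :
    ∑ j, (1 / φ j) * w j ^ 2 =
      ∑ j, (1 / φ j) * v j ^ 2 + ∑ j, (1 / φ j) * (w j - v j) ^ 2 := by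
  have cross : ∑ j, (Y j ⬝ᵥ a) * (w j - v j) = 0 := by
    simp only [dotProduct, Finset.sum_mul]
    rw [Finset.sum_comm]
    refine Finset.sum_eq_zero fun s _ => ?_
    calc ∑ j, Y j s * a s * (w j - v j)
        = a s * (∑ j, Y j s * w j - ∑ j, Y j s * v j) := by
          rw [← Finset.sum_sub_distrib, Finset.mul_sum]
          exact Finset.sum_congr rfl fun j _ => by ring
      _ = 0 := by rw [h s, sub_self, mul_zero]
  have expand : ∑ j, (1 / φ j) * w j ^ 2 =
      ∑ j, (1 / φ j) * v j ^ 2 + ∑ j, (1 / φ j) * (w j - v j) ^ 2 +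
        2 * ∑ j, (Y j ⬝ᵥ a) * (w j - v j) := by
    rw [Finset.mul_sum, ← Finset.sum_add_distrib, ← Finset.sum_add_distrib]
    refine Finset.sum_congr rfl fun j _ => ?_
    have hφj := (hφ j).ne'
    have hd : Y j ⬝ᵥ a = v j / φ j := by rw [hv j, mul_div_cancel_left₀ _ hφj]
    rw [hd]
    field_simp
    ring
  rw [expand, cross, mul_zero, add_zero]

end WeightedLeastNorm

/-- The extended moment constraints are the moment constraints and the prescribed weight. -/
theorem sum_snoc_mul_eq_snoc_iff {ι : Type*} [Fintype ι] [DecidableEq ι] {p : ℕ}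
    (X : ι → Fin p → ℝ) (C : Fin p → ℝ) (i : ι) (c : ℝ) (w : ι → ℝ) :
    (∀ s, ∑ j, (Fin.snoc (X j) (if j = i then (1 : ℝ) else 0) : Fin (p + 1) → ℝ) s * w j =
      (Fin.snoc C c : Fin (p + 1) → ℝ) s) ↔
      (∀ s, ∑ j, X j s * w j = C s) ∧ w i = c := by
  simp [Fin.forall_fin_succ']

/-- Finite Pointset Method with prescribed central weight: with extended monomial vectors
`X⁺ⱼ = (Xⱼ, δⱼᵢ)`, extended target `C⁺ = (C, c)` and invertible extended moment matrix
`M⁺ = Σⱼ φⱼ X⁺ⱼ (X⁺ⱼ)ᵀ`, the weights `w*ⱼ = φⱼ X⁺ⱼ · ((M⁺)⁻¹ C⁺)` satisfy the moment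
constraints `Σⱼ Xⱼ wⱼ = C` and the central-weight constraint `wᵢ = c`, and they uniquely
minimize `J(w) = Σⱼ (1/φⱼ) wⱼ²` over all weights satisfying both constraints. -/
theorem fpsm_extended_constraint_minimizer
    (N p : ℕ)
    (X : Fin N → Fin p → ℝ) (C : Fin p → ℝ)
    (φ : Fin N → ℝ) (hφ : ∀ j, 0 < φ j)
    (i : Fin N) (c : ℝ)
    (Xp : Fin N → Fin (p + 1) → ℝ)
    (hXp : ∀ j, Xp j = Fin.snoc (X j) (if j = i then (1 : ℝ) else 0))
    (Cp : Fin (p + 1) → ℝ) (hCp : Cp = Fin.snoc C c)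
    (Mp : Matrix (Fin (p + 1)) (Fin (p + 1)) ℝ)
    (hMp : Mp = Matrix.of fun s t => ∑ j, φ j * Xp j s * Xp j t)
    (hMinv : IsUnit Mp.det)
    (J : (Fin N → ℝ) → ℝ) (hJ : ∀ w, J w = ∑ j, (1 / φ j) * w j ^ 2)
    (wstar : Fin N → ℝ) (hw : ∀ j, wstar j = φ j * (Xp j ⬝ᵥ (Mp⁻¹ *ᵥ Cp))) :
    ((∀ s, ∑ j, X j s * wstar j = C s) ∧ wstar i = c) ∧
      ∀ w : Fin N → ℝ, ((∀ s, ∑ j, X j s * w j = C s) ∧ w i = c) →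
        (J wstar ≤ J w ∧ (J w = J wstar → w = wstar)) := by
  have feasible_iff : ∀ w : Fin N → ℝ, (∀ s, ∑ j, Xp j s * w j = Cp s) ↔
      (∀ s, ∑ j, X j s * w j = C s) ∧ w i = c := by
    intro w
    simp only [hXp, hCp]
    exact sum_snoc_mul_eq_snoc_iff X C i c w
  have hstar : ∀ s, ∑ j, Xp j s * wstar j = Cp s := by
    intro s
    simp only [hw]
    rw [sum_mul_weighted_dotProduct, ← hMp, mulVec_mulVec, mul_nonsing_inv _ hMinv, one_mulVec]
  refine ⟨(feasible_iff wstar).1 hstar, fun w hfeas => ?_⟩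
  have hpyth := sum_weighted_sq_eq_add hφ hw
    fun s => ((feasible_iff w).2 hfeas s).trans (hstar s).symm
  rw [← hJ, ← hJ] at hpyth
  have hnonneg : ∀ j ∈ Finset.univ, 0 ≤ (1 / φ j) * (w j - wstar j) ^ 2 := fun j _ =>
    mul_nonneg (one_div_pos.2 (hφ j)).le (sq_nonneg _)
  refine ⟨by linarith [Finset.sum_nonneg hnonneg], fun heq => funext fun j => ?_⟩
  have hzero : ∑ j, (1 / φ j) * (w j - wstar j) ^ 2 = 0 := by linarith
  have hj := (Finset.sum_eq_zero_iff_of_nonneg hnonneg).1 hzero j (Finset.mem_univ j)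
  have hsq := (mul_eq_zero.1 hj).resolve_left (one_div_pos.2 (hφ j)).ne'
  exact sub_eq_zero.1 (pow_eq_zero_iff two_ne_zero |>.1 hsq)
end
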